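/- Let α' ≥ 0, τ₀ ∈ ℝ, and set χ(τ) = ψ(τ) = (1 + e^{2(τ−τ₀)})⁻¹ and h ≡ 0. Define f : ℝ → ℝ by f(τ) = ½·log(e^{2τ} + (α'/2)(1 − χ(τ)²)) (the argument of the logarithm is strictly positive). Then for all τ ∈ ℝ: (i) χ'(τ) = 2·e^{−2h(τ)}·(ψ(τ)² − χ(τ)) — trivially satisfied since χ = ψ and both sides equal 2(χ² − χ); (ii) ψ'(τ) = 2·ψ(τ)·(χ(τ) − 1); and (iii) e^{2(f(τ)+h(τ))}·(f'(τ) + h'(τ) − e^{−2h(τ)}) = (α'/2)·(χ(τ)² − 2χ(τ)ψ(τ)² + 2ψ(τ)² − 1). -/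

import Mathlib

theorem hasDerivAt_inv_one_add_exp (τ₀ τ : ℝ) :
    HasDerivAt (fun τ => (1 + Real.exp (2 * (τ - τ₀)))⁻¹)
      (2 * (((1 + Real.exp (2 * (τ - τ₀)))⁻¹) ^ 2 - (1 + Real.exp (2 * (τ - τ₀)))⁻¹)) τ := by
  have hne : 1 + Real.exp (2 * (τ - τ₀)) ≠ 0 := by positivity
  refine (((((hasDerivAt_id' τ).sub_const τ₀).const_mul 2).exp.const_add 1).fun_inv hne).congr_deriv ?_
  field_simp
  ring

theorem inv_one_add_exp_sq_le_one (x : ℝ) : ((1 + Real.exp x)⁻¹) ^ 2 ≤ 1 :=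
  pow_le_one₀ (by positivity) (inv_le_one_of_one_le₀ (by linarith [Real.exp_pos x]))


/-- The exact heterotic supergravity solution on the cone over a 3-dimensional
Sasaki–Einstein manifold (the `m = 1` case, Strominger's solution):
`χ = ψ = (1 + e^{2(τ−τ₀)})⁻¹`, `h ≡ 0` and `e^{2f} = e^{2τ} + (α'/2)(1 − χ²)`
satisfy the flow equations and the reduced Bianchi identity. -/
theorem heterotic_sasaki_einstein_m1 (α' : ℝ) (hα : 0 ≤ α') (τ₀ : ℝ) :
    let χ : ℝ → ℝ := fun τ => (1 + Real.exp (2 * (τ - τ₀)))⁻¹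
    let ψ : ℝ → ℝ := χ
    let h : ℝ → ℝ := fun _ => 0
    let f : ℝ → ℝ := fun τ =>
      (1 / 2) * Real.log (Real.exp (2 * τ) + (α' / 2) * (1 - (χ τ) ^ 2))
    (∀ τ : ℝ, 0 < Real.exp (2 * τ) + (α' / 2) * (1 - (χ τ) ^ 2)) ∧
    (∀ τ : ℝ, deriv χ τ = 2 * Real.exp (-(2 * h τ)) * ((ψ τ) ^ 2 - χ τ)) ∧
    (∀ τ : ℝ, deriv ψ τ = 2 * ψ τ * (χ τ - 1)) ∧
    (∀ τ : ℝ, Real.exp (2 * (f τ + h τ))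
        * (deriv f τ + deriv h τ - Real.exp (-(2 * h τ)))
      = (α' / 2) * ((χ τ) ^ 2 - 2 * χ τ * (ψ τ) ^ 2 + 2 * (ψ τ) ^ 2 - 1)) := by
  intro χ ψ h f
  have hχ (τ : ℝ) : HasDerivAt χ (2 * ((χ τ) ^ 2 - χ τ)) τ := hasDerivAt_inv_one_add_exp τ₀ τ
  have hpos (τ : ℝ) : 0 < Real.exp (2 * τ) + (α' / 2) * (1 - (χ τ) ^ 2) :=
    add_pos_of_pos_of_nonneg (Real.exp_pos _)
      (mul_nonneg (by positivity) (sub_nonneg.2 (inv_one_add_exp_sq_le_one _)))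
  refine ⟨hpos, fun τ => ?_, fun τ => ?_, fun τ => ?_⟩
  · rw [(hχ τ).deriv]
    simp [ψ, h]
  · rw [(hχ τ).deriv]
    simp only [ψ]
    ring
  · have hA : HasDerivAt (fun τ => Real.exp (2 * τ) + (α' / 2) * (1 - (χ τ) ^ 2))
        (2 * Real.exp (2 * τ) - α' * χ τ * (2 * ((χ τ) ^ 2 - χ τ))) τ := by
      refine (((hasDerivAt_id' τ).const_mul 2).exp.fun_add
        ((((hχ τ).fun_pow 2).const_sub 1).const_mul (α' / 2))).congr_deriv ?_
      push_cast
      ring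
    have hf : deriv f τ = (1 / 2) * ((2 * Real.exp (2 * τ) - α' * χ τ * (2 * ((χ τ) ^ 2 - χ τ))) /
        (Real.exp (2 * τ) + (α' / 2) * (1 - (χ τ) ^ 2))) :=
      ((hA.log (hpos τ).ne').const_mul (1 / 2)).deriv
    have hexp : Real.exp (2 * (f τ + h τ)) =
        Real.exp (2 * τ) + (α' / 2) * (1 - (χ τ) ^ 2) := by
      rw [← Real.exp_log (hpos τ)]
      congr 1
      simp only [f, h]
      ring
    have hh : deriv h τ = 0 := deriv_const τ 0
    have hne := (hpos τ).ne'
    rw [hexp, hf, hh]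
    simp only [h, ψ, mul_zero, neg_zero, Real.exp_zero, add_zero]
    rw [mul_sub, mul_left_comm, mul_div_cancel₀ _ hne]
    ring
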